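/- arXiv:2603.24948 — 2 statements merged into one kernel-verified Lean document; each statement's English description precedes it below -/
import Mathlib

section
/- Let n > 0, μ₀ > 0, H > 0 and c < 0 be real constants, and define u : ℝ → ℝ by u(y) = (n/(n+1)) · (-c/μ₀)^(1/n) · ((H/2)^(1+1/n) - |y|^(1+1/n)). Then for every y ∈ (-H/2, H/2) with y ≠ 0, u is differentiable at y with derivative u'(y) = -(-c/μ₀)^(1/n) · |y|^(1/n) · sign(y), and the shear stress satisfies the identity μ₀ · |u'(y)|^(n-1) · u'(y) = c · y. Moreover u is differentiable at 0 with u'(0) = 0. -/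
lemma abs_mul_real_sign (y : ℝ) : |y| * Real.sign y = y := by
  rcases lt_trichotomy y 0 with h | rfl | h
  · rw [Real.sign_of_neg h, abs_of_neg h]; ring
  · simp
  · rw [Real.sign_of_pos h, abs_of_pos h]; ring

lemma abs_real_sign_of_ne_zero {y : ℝ} (hy : y ≠ 0) : |Real.sign y| = 1 := by
  rcases Real.sign_apply_eq_of_ne_zero y hy with h | h <;> simp [h]

lemma abs_rpow_sub_one_mul_self (q y : ℝ) :
    |y| ^ (q - 1) * y = |y| ^ q * Real.sign y := by
  rcases eq_or_ne y 0 with rfl | hy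
  · simp
  · have h : 0 < |y| := abs_pos.mpr hy
    rw [Real.rpow_sub_one h.ne']
    calc |y| ^ q / |y| * y = |y| ^ q / |y| * (|y| * Real.sign y) := by rw [abs_mul_real_sign]
      _ = |y| ^ q * Real.sign y := by rw [← mul_assoc, div_mul_cancel₀ _ h.ne']

lemma hasDerivAt_const_mul_sub_abs_rpow {n : ℝ} (hn : 0 < n) (A B y : ℝ) :
    HasDerivAt (fun y : ℝ => n / (n + 1) * A * (B - |y| ^ (1 + 1 / n)))
      (-A * |y| ^ (1 / n) * Real.sign y) y := by
  have hp : 1 < 1 + 1 / n := lt_add_of_pos_right 1 (one_div_pos.mpr hn)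
  refine (((hasDerivAt_abs_rpow y hp).const_sub B).const_mul (n / (n + 1) * A)).congr_deriv ?_
  rw [mul_assoc (1 + 1 / n), show 1 + 1 / n - 2 = 1 / n - 1 by ring,
    abs_rpow_sub_one_mul_self]
  field_simp

lemma abs_rpow_sub_one_mul_of_root {n a y : ℝ} (hn : 0 < n) (ha : 0 < a) (hy : y ≠ 0) :
    |-(a ^ (1 / n)) * |y| ^ (1 / n) * Real.sign y| ^ (n - 1) *
      (-(a ^ (1 / n)) * |y| ^ (1 / n) * Real.sign y) = -(a * y) := by
  have hy' : 0 < |y| := abs_pos.mpr hy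
  have hw : 0 < (a * |y|) ^ (1 / n) := Real.rpow_pos_of_pos (mul_pos ha hy') _
  rw [neg_mul, ← Real.mul_rpow ha.le hy'.le, abs_mul, abs_neg, abs_of_pos hw,
    abs_real_sign_of_ne_zero hy, mul_one, ← mul_assoc, mul_neg, Real.rpow_sub_one hw.ne',
    div_mul_cancel₀ _ hw.ne', ← Real.rpow_mul (mul_pos ha hy').le,
    one_div_mul_cancel hn.ne', Real.rpow_one, neg_mul, mul_assoc, abs_mul_real_sign]


/-- The power-law channel-flow profile `u` is differentiable away from `0` on
`(-H/2, H/2)` with derivative `u'(y) = -(-c/μ₀)^(1/n) · |y|^(1/n) · sign y`,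
the shear stress satisfies `μ₀ · |u'(y)|^(n-1) · u'(y) = c · y`, and `u` is
differentiable at `0` with `u'(0) = 0`. -/
theorem channel_flow_derivative (n μ₀ H c : ℝ)
    (hn : 0 < n) (hμ₀ : 0 < μ₀) (hH : 0 < H) (hc : c < 0)
    (u : ℝ → ℝ)
    (hu : ∀ y, u y = (n / (n + 1)) * ((-c) / μ₀) ^ (1 / n) *
        ((H / 2) ^ (1 + 1 / n) - |y| ^ (1 + 1 / n))) :
    (∀ y ∈ Set.Ioo (-(H / 2)) (H / 2), y ≠ 0 →
      HasDerivAt u (-(((-c) / μ₀) ^ (1 / n)) * |y| ^ (1 / n) * Real.sign y) y ∧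
      μ₀ * |(-(((-c) / μ₀) ^ (1 / n)) * |y| ^ (1 / n) * Real.sign y)| ^ (n - 1) *
        (-(((-c) / μ₀) ^ (1 / n)) * |y| ^ (1 / n) * Real.sign y) = c * y) ∧
    HasDerivAt u 0 0 := by
  have hderiv := hasDerivAt_const_mul_sub_abs_rpow hn ((-c / μ₀) ^ (1 / n))
    ((H / 2) ^ (1 + 1 / n))
  rw [← funext hu] at hderiv
  refine ⟨fun y _ hy => ⟨hderiv y, ?_⟩, by simpa using hderiv 0⟩
  rw [mul_assoc, abs_rpow_sub_one_mul_of_root hn (div_pos (neg_pos.mpr hc) hμ₀) hy]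
  field_simp
end

section
/- Let μ₀ > 0, μ₁ ∈ ℝ, H > 0 and c < 0 be real constants, and let u : ℝ → ℝ be the power-law channel-flow solution with index n = 1/4, i.e. u(y) = (1/5) · (c/μ₀)⁴ · ((H/2)⁵ - |y|⁵). Then u is twice differentiable on (-H/2, H/2) with u''(y) = -4 (c/μ₀)⁴ |y|³, and defining the correction term s(y) = 4 μ₁ c⁴ |y|³ / μ₀⁴ + c, the corrected constant-viscosity (Newtonian) equation μ₁ · u''(y) - c + s(y) = 0 holds for every y ∈ (-H/2, H/2), with right-hand side f(y) = 0. -/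
/-- The derivative of `x ↦ |x| ^ (n + 2)`, valid also at the origin. -/
theorem hasDerivAt_abs_pow_add_two (n : ℕ) (x : ℝ) :
    HasDerivAt (fun x : ℝ => |x| ^ (n + 2)) ((n + 2) * |x| ^ n * x) x := by
  have h := hasDerivAt_abs_rpow x (p := n + 2) (by linarith [n.cast_nonneg (α := ℝ)])
  rw [add_sub_cancel_right] at h
  exact_mod_cast h

/-- The derivative of `x ↦ |x| ^ (n + 2) * x`, valid also at the origin. -/
theorem hasDerivAt_abs_pow_add_two_mul_self (n : ℕ) (x : ℝ) :
    HasDerivAt (fun x : ℝ => |x| ^ (n + 2) * x) ((n + 3) * |x| ^ (n + 2)) x := by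
  refine ((hasDerivAt_abs_pow_add_two n x).mul (hasDerivAt_id x)).congr_deriv ?_
  simp only [id_eq, pow_add, sq_abs]
  ring

/-- The power-law channel-flow solution with index `n = 1/4`,
`u(y) = (1/5) (c/μ₀)⁴ ((H/2)⁵ - |y|⁵)`, is twice differentiable on
`(-H/2, H/2)` with `u''(y) = -4 (c/μ₀)⁴ |y|³`, and with the correction term
`s(y) = 4 μ₁ c⁴ |y|³ / μ₀⁴ + c` the corrected constant-viscosity equation
`μ₁ u''(y) - c + s(y) = 0` holds on `(-H/2, H/2)` (right-hand side `f ≡ 0`). -/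
theorem channel_flow_model_correction (μ₀ μ₁ H c : ℝ)
    (hμ₀ : 0 < μ₀) (hH : 0 < H) (hc : c < 0)
    (u s : ℝ → ℝ)
    (hu : ∀ y, u y = (1 / 5) * (c / μ₀) ^ 4 * ((H / 2) ^ 5 - |y| ^ 5))
    (hs : ∀ y, s y = 4 * μ₁ * c ^ 4 * |y| ^ 3 / μ₀ ^ 4 + c) :
    ∀ y ∈ Set.Ioo (-(H / 2)) (H / 2),
      DifferentiableAt ℝ u y ∧
      HasDerivAt (deriv u) (-(4 * (c / μ₀) ^ 4 * |y| ^ 3)) y ∧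
      μ₁ * (-(4 * (c / μ₀) ^ 4 * |y| ^ 3)) - c + s y = 0 := by
  have hderiv (x : ℝ) : HasDerivAt u (-(c / μ₀) ^ 4 * (|x| ^ 3 * x)) x := by
    rw [funext hu]
    refine (((hasDerivAt_abs_pow_add_two 3 x).const_sub ((H / 2) ^ 5)).const_mul
      ((1 / 5) * (c / μ₀) ^ 4)).congr_deriv ?_
    push_cast
    ring
  intro y _
  refine ⟨(hderiv y).differentiableAt, ?_, ?_⟩
  · rw [funext fun x => (hderiv x).deriv]
    refine ((hasDerivAt_abs_pow_add_two_mul_self 1 y).const_mul _).congr_deriv ?_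
    push_cast
    ring
  · rw [hs]
    field_simp
    ring
end
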